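/- arXiv:1109.3952 — 4 statements merged into one kernel-verified Lean document; each statement's English description precedes it below -/
import Mathlib

section
/- For all reals P1, P2 with 0 ≤ P1 ≤ P2, the set of tuples in C_ma(P1, P2) with R12 ≤ R21 equals the set of tuples of the form (R0, R0 + δ, R1r', R2r' − δ) for which there exist α ∈ [0,1] and reals R0, δ, R1r', R2r' ≥ 0 satisfying: R0 = α·C(P1); R1r' ≤ (1−α)·C(P1); R2r' ≤ C(P2) − α·C(P1); R1r' + R2r' ≤ C(P1 + P2) − α·C(P1); and 0 ≤ δ ≤ R2r'. -/
noncomputable def C (x : ℝ) : ℝ := (1/2) * Real.logb 2 (1 + x)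

def Cma (P1 P2 : ℝ) : Set (ℝ × ℝ × ℝ × ℝ) :=
  {r | 0 ≤ r.1 ∧ 0 ≤ r.2.1 ∧ 0 ≤ r.2.2.1 ∧ 0 ≤ r.2.2.2 ∧
    r.2.2.1 + r.1 ≤ C P1 ∧ r.2.2.2 + r.2.1 ≤ C P2 ∧
    r.2.2.1 + r.2.2.2 + max r.1 r.2.1 ≤ C (P1 + P2)}

theorem Cma_reparam (P1 P2 : ℝ) (h1 : 0 ≤ P1) (h2 : P1 ≤ P2) :
    {r ∈ Cma P1 P2 | r.1 ≤ r.2.1} =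
    {r : ℝ × ℝ × ℝ × ℝ | ∃ α R0 δ R1r' R2r' : ℝ,
      0 ≤ α ∧ α ≤ 1 ∧ 0 ≤ R0 ∧ 0 ≤ δ ∧ 0 ≤ R1r' ∧ 0 ≤ R2r' ∧
      R0 = α * C P1 ∧
      R1r' ≤ (1 - α) * C P1 ∧
      R2r' ≤ C P2 - α * C P1 ∧
      R1r' + R2r' ≤ C (P1 + P2) - α * C P1 ∧
      δ ≤ R2r' ∧
      r = (R0, R0 + δ, R1r', R2r' - δ)} := by
  ext ⟨a, b, c, d⟩
  simp only [Cma, Set.mem_setOf_eq, Prod.mk.injEq]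
  constructor
  · rintro ⟨⟨ha, hb, hc, hd, e1, e2, e3⟩, hab⟩
    rw [max_eq_right hab] at e3
    have hC : 0 ≤ C P1 := by linarith
    have key : a = a / C P1 * C P1 := by
      rcases hC.eq_or_lt with h | h
      · rw [← h]
        linarith
      · rw [div_mul_cancel₀ _ h.ne']
    refine ⟨a / C P1, a, b - a, c, d + (b - a), by positivity,
      div_le_one_of_le₀ (by linarith) hC, ha, by linarith, hc, by linarith, key,
      ?_, ?_, ?_, by linarith, rfl, by ring, rfl, by ring⟩
    · rw [sub_mul, ← key]
      linarith
    · rw [← key]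
      linarith
    · rw [← key]
      linarith
  · rintro ⟨α, R0, δ, R1, R2, h0, h1', hR0, hδ, hR1, hR2, e, e1, e2, e3, e4, rfl, rfl, rfl, rfl⟩
    rw [sub_mul, ← e] at e1
    rw [← e] at e2 e3
    rw [max_eq_right (by linarith)]
    refine ⟨⟨?_, ?_, ?_, ?_, ?_, ?_, ?_⟩, ?_⟩ <;> linarith
end

section
/- (Lemma 1, half-bit optimality of the EER-BR MAC-phase region.) For all reals P1, P2 with 0 ≤ P1 ≤ P2 and every tuple r = (R12, R21, R1r, R2r) ∈ C_ma(P1, P2), there exists a tuple p ∈ R_ma(P1, P2) such that r_i − 1/2 ≤ p_i ≤ r_i for each of the four coordinates i. -/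
noncomputable def D (x : ℝ) : ℝ := (1/2) * max 0 (Real.logb 2 (1/2 + x))

noncomputable def Rts' (P1 P2 α : ℝ) : Set (ℝ × ℝ) :=
  {p | 0 ≤ p.1 ∧ 0 ≤ p.2 ∧
    p.1 ≤ (1 - α) * C P1 ∧
    p.2 ≤ (1 - α) * C P2 + α * C ((P2 - P1) / (1 + 2*P1)) ∧
    p.1 + p.2 ≤ (1 - α) * C (P1 + P2) + α * C ((P2 - P1) / (1 + 2*P1))}

noncomputable def Rma (P1 P2 : ℝ) : Set (ℝ × ℝ × ℝ × ℝ) :=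
  {r | ∃ α R0 δ R1r R2r : ℝ, 0 ≤ α ∧ α ≤ 1 ∧ R0 = α * D P1 ∧
      (R1r, R2r) ∈ Rts' P1 P2 α ∧ 0 ≤ δ ∧ δ ≤ R2r ∧
      r = (R0, R0 + δ, R1r, R2r - δ)} ∪
  {r | ∃ α R0 δ R1r R2r : ℝ, 0 ≤ α ∧ α ≤ 1 ∧ R0 = α * D P1 ∧
      (R1r, R2r) ∈ Rts' P1 P2 α ∧ 0 ≤ δ ∧ δ ≤ R1r ∧
      r = (R0 + δ, R0, R1r - δ, R2r)}

theorem C_mono_aux {x y : ℝ} (hx : 0 ≤ x) (h : x ≤ y) : C x ≤ C y := by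
  unfold C
  have := Real.logb_le_logb_of_le (b := 2) (by norm_num) (by linarith : (0:ℝ) < 1 + x)
    (by linarith : 1 + x ≤ 1 + y)
  linarith

theorem C_quot_aux {P1 P2 : ℝ} (h1 : 0 ≤ P1) (h2 : P1 ≤ P2) :
    C ((P2 - P1) / (1 + 2*P1)) = C (P1 + P2) - C (2*P1) := by
  unfold C
  have h : 1 + (P2 - P1) / (1 + 2*P1) = (1 + (P1 + P2)) / (1 + 2*P1) := by
    have : (1 + 2*P1) ≠ 0 := by positivity
    field_simp
    ring
  rw [h, Real.logb_div (by linarith) (by linarith)]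
  ring

theorem D_eq_aux {P1 : ℝ} (h1 : 0 ≤ P1) : D P1 = max 0 (C (2*P1) - 1/2) := by
  unfold D C
  have h : 1/2 + P1 = (1 + 2*P1) / 2 := by ring
  rw [h, Real.logb_div (by linarith) (by norm_num), Real.logb_self_eq_one (by norm_num),
    mul_max_of_nonneg _ _ (by norm_num)]
  congr 1 <;> ring

theorem EER_BR_half_bit_MAC (P1 P2 : ℝ) (h1 : 0 ≤ P1) (h2 : P1 ≤ P2)
    (r : ℝ × ℝ × ℝ × ℝ) (hr : r ∈ Cma P1 P2) :
    ∃ p ∈ Rma P1 P2,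
      r.1 - 1/2 ≤ p.1 ∧ p.1 ≤ r.1 ∧
      r.2.1 - 1/2 ≤ p.2.1 ∧ p.2.1 ≤ r.2.1 ∧
      r.2.2.1 - 1/2 ≤ p.2.2.1 ∧ p.2.2.1 ≤ r.2.2.1 ∧
      r.2.2.2 - 1/2 ≤ p.2.2.2 ∧ p.2.2.2 ≤ r.2.2.2 := by
  obtain ⟨a, b, x, y⟩ := r
  obtain ⟨ha, hb, hx, hy, h3, h4, h5⟩ := hr
  simp only at ha hb hx hy h3 h4 h5
  have e1 := C_quot_aux h1 h2
  have e2 := D_eq_aux h1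
  have m1 : C P1 ≤ C (2*P1) := C_mono_aux h1 (by linarith)
  have m2 : C P2 ≤ C (P1 + P2) := C_mono_aux (by linarith) (by linarith)
  have ma := le_max_left a b
  have mb := le_max_right a b
  unfold Rma Rts'
  rw [e1, e2]
  generalize C (2*P1) = t at *
  generalize C (P1 + P2) = s at *
  generalize C P1 = c1 at *
  generalize C P2 = c2 at *
  rcases le_total (t - 1/2) 0 with ht | ht
  · rw [max_eq_left ht]
    refine ⟨(0, b, 0, y), Or.inl ⟨0, 0, b, 0, y + b, ?_⟩, ?_⟩
    · simp only [Set.mem_ofPred_eq, Prod.mk.injEq]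
      refine ⟨?_, ?_, ?_, ⟨?_, ?_, ?_, ?_, ?_⟩, ?_, ?_, ?_, ?_, ?_, ?_⟩ <;> first | trivial | linarith
    · simp only
      refine ⟨?_, ?_, ?_, ?_, ?_, ?_, ?_, ?_⟩ <;> first | trivial | linarith
  · rw [max_eq_right ht]
    have tp : 0 < t := by linarith
    rcases le_total a b with hab | hab
    · obtain ⟨α, hα⟩ : ∃ α, α = a / t := ⟨_, rfl⟩
      have hat : α * t = a := by rw [hα]; field_simp
      have a0 : 0 ≤ α := by rw [hα]; positivity
      have a1 : α ≤ 1 := by rw [hα, div_le_one tp]; linarith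
      have k1 := mul_le_mul_of_nonneg_left m1 a0
      have k2 := mul_le_mul_of_nonneg_left m2 a0
      refine ⟨(a - α/2, b - α/2, x, y),
        Or.inl ⟨α, a - α/2, b - a, x, y + b - a, ?_⟩, ?_⟩
      · simp only [Set.mem_ofPred_eq, Prod.mk.injEq]
        refine ⟨?_, ?_, ?_, ⟨?_, ?_, ?_, ?_, ?_⟩, ?_, ?_, ?_, ?_, ?_, ?_⟩ <;> first | trivial | linarith
      · simp only
        refine ⟨?_, ?_, ?_, ?_, ?_, ?_, ?_, ?_⟩ <;> first | trivial | linarith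
    · obtain ⟨α, hα⟩ : ∃ α, α = b / t := ⟨_, rfl⟩
      have hat : α * t = b := by rw [hα]; field_simp
      have a0 : 0 ≤ α := by rw [hα]; positivity
      have a1 : α ≤ 1 := by rw [hα, div_le_one tp]; linarith
      have k1 := mul_le_mul_of_nonneg_left m1 a0
      have k2 := mul_le_mul_of_nonneg_left m2 a0
      refine ⟨(a - α/2, b - α/2, x, y),
        Or.inr ⟨α, b - α/2, a - b, x + a - b, y, ?_⟩, ?_⟩
      · simp only [Set.mem_ofPred_eq, Prod.mk.injEq]
        refine ⟨?_, ?_, ?_, ⟨?_, ?_, ?_, ?_, ?_⟩, ?_, ?_, ?_, ?_, ?_, ?_⟩ <;> first | trivial | linarith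
      · simp only
        refine ⟨?_, ?_, ?_, ?_, ?_, ?_, ?_, ?_⟩ <;> first | trivial | linarith
end

section
/- (The gap between the conventional-MAC region and the outer bound is unbounded at high SNR.) For every real M > 0 there exists a real P > 0 such that, taking P1 = P2 = P, the tuple (C(P), C(P), 0, 0) belongs to C_ma(P, P), yet 2·C(P) − C(2·P) > M; in particular this tuple violates the sum-rate constraint R1r + R2r + R12 + R21 ≤ C(P1 + P2) defining R_1,ma(P, P) by more than M. -/
theorem conventional_MAC_gap_unbounded (M : ℝ) (hM : 0 < M) :
    ∃ P : ℝ, 0 < P ∧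
      ((C P, C P, (0:ℝ), (0:ℝ)) ∈ Cma P P) ∧
      2 * C P - C (2*P) > M := by
  have ht : (0:ℝ) < (2:ℝ) ^ (2 * M) := by positivity
  have hlt : Real.logb 2 ((2:ℝ) ^ (2 * M)) = 2 * M :=
    Real.logb_rpow (by norm_num) (by norm_num)
  generalize (2:ℝ) ^ (2 * M) = t at ht hlt
  have h0 : 0 ≤ C (2 * t) := by
    unfold C
    have := Real.logb_nonneg (b := 2) (x := 1 + 2 * t) (by norm_num) (by linarith)
    linarith
  have h1 : C (2 * t) ≤ C (2 * t + 2 * t) := by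
    unfold C
    have := Real.logb_le_logb_of_le (b := 2) (x := 1 + 2 * t) (y := 1 + (2 * t + 2 * t))
      (by norm_num) (by linarith) (by linarith)
    linarith
  refine ⟨2 * t, by linarith, ?_, ?_⟩
  · simp only [Cma, Set.mem_setOf_eq, max_self]
    refine ⟨h0, h0, le_refl _, le_refl _, ?_, ?_, ?_⟩ <;> linarith
  · unfold C
    have h2 : Real.logb 2 (t * (1 + 2 * (2 * t))) < Real.logb 2 ((1 + 2 * t) * (1 + 2 * t)) :=
      Real.logb_lt_logb (by norm_num) (by positivity) (by nlinarith)
    rw [Real.logb_mul (by positivity) (by positivity),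
      Real.logb_mul (by positivity) (by positivity), hlt] at h2
    linarith
end

section
/- (Per-coordinate half-bit comparison used in the proof of Lemma 1.) For all reals P1, P2 with 0 ≤ P1 ≤ P2 and every α ∈ [0,1]: (i) α·C(P1) − α·D(P1) ≤ (1/2)·log₂(3/2) < 1/2; (ii) [C(P2) − α·C(P1)] − [(1−α)·C(P2) + α·C((P2 − P1)/(1 + 2·P1))] = α·(Γ − C(P1)) ≤ 1/2, where Γ = C(2·P1) + C(P2) − C(P1 + P2); (iii) [C(P1 + P2) − α·C(P1)] − [(1−α)·C(P1 + P2) + α·C((P2 − P1)/(1 + 2·P1))] = α·(C(2·P1) − C(P1)) ≤ 1/2. -/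
theorem per_coordinate_half_bit (P1 P2 : ℝ) (h1 : 0 ≤ P1) (h2 : P1 ≤ P2)
    (α : ℝ) (hα0 : 0 ≤ α) (hα1 : α ≤ 1) :
    (α * C P1 - α * D P1 ≤ (1/2) * Real.logb 2 (3/2) ∧
      (1/2) * Real.logb 2 (3/2) < 1/2) ∧
    ((C P2 - α * C P1) - ((1 - α) * C P2 + α * C ((P2 - P1) / (1 + 2*P1)))
        = α * ((C (2*P1) + C P2 - C (P1 + P2)) - C P1) ∧
      α * ((C (2*P1) + C P2 - C (P1 + P2)) - C P1) ≤ 1/2) ∧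
    ((C (P1 + P2) - α * C P1) - ((1 - α) * C (P1 + P2) + α * C ((P2 - P1) / (1 + 2*P1)))
        = α * (C (2*P1) - C P1) ∧
      α * (C (2*P1) - C P1) ≤ 1/2) := by
  have hL : ∀ x y : ℝ, 0 < x → x ≤ y → Real.logb 2 x ≤ Real.logb 2 y := fun x y hx hxy =>
    Real.logb_le_logb_of_le (by norm_num) hx hxy
  have h22 : Real.logb 2 2 = 1 := Real.logb_self_eq_one (by norm_num)
  have h32 : Real.logb 2 (3/2) < 1 := by
    rw [← h22]
    exact Real.logb_lt_logb (by norm_num) (by norm_num) (by norm_num)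
  have h320 : 0 < Real.logb 2 (3/2) := Real.logb_pos (by norm_num) (by norm_num)
  have hscale : ∀ x B : ℝ, 0 ≤ B → x ≤ B → α * x ≤ B := fun x B hB hx =>
    (mul_le_mul_of_nonneg_left hx hα0).trans (mul_le_of_le_one_left hB hα1)
  have hCD : C P1 - D P1 ≤ (1/2) * Real.logb 2 (3/2) := by
    unfold C D
    rcases le_total P1 (1/2) with h | h
    · have a := hL (1 + P1) (3/2) (by linarith) (by linarith)
      have b := le_max_left 0 (Real.logb 2 (1/2 + P1))
      linarith
    · have a := hL (1 + P1) ((3/2) * (1/2 + P1)) (by linarith) (by linarith)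
      rw [Real.logb_mul (by norm_num) (by linarith)] at a
      have b := le_max_right 0 (Real.logb 2 (1/2 + P1))
      linarith
  have hq : C ((P2 - P1) / (1 + 2*P1)) = C (P1 + P2) - C (2*P1) := by
    unfold C
    have e : 1 + (P2 - P1) / (1 + 2*P1) = (1 + (P1 + P2)) / (1 + 2*P1) := by
      have : (1 + 2*P1) ≠ 0 := by linarith
      field_simp
      ring
    rw [e, Real.logb_div (by linarith) (by linarith)]
    ring
  have h3 : C (2*P1) - C P1 ≤ 1/2 := by
    unfold C
    have a := hL (1 + 2*P1) (2 * (1 + P1)) (by linarith) (by linarith)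
    rw [Real.logb_mul (by norm_num) (by linarith), h22] at a
    linarith
  have h4 : C P2 ≤ C (P1 + P2) := by
    unfold C
    have a := hL (1 + P2) (1 + (P1 + P2)) (by linarith) (by linarith)
    linarith
  refine ⟨⟨?_, by linarith⟩, ⟨?_, ?_⟩, ?_, ?_⟩
  · rw [← mul_sub]
    exact hscale _ _ (by linarith) hCD
  · rw [hq]; ring
  · exact hscale _ _ (by norm_num) (by linarith)
  · rw [hq]; ring
  · exact hscale _ _ (by norm_num) h3
end
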